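/- arXiv:2411.09482 — 2 statements merged into one kernel-verified Lean document; each statement's English description precedes it below -/
import Mathlib

section
/- Let d ≥ 2 be an integer, s ∈ (1, d/2), α ∈ (0,1), and let C₀ > 0. Let φ : ℝ^d → [0,1] be a C² function with |Dφ(n)| ≤ C₀ |n|^{−1} and |D²φ(n)| ≤ C₀ |n|^{−2} for all n ≠ 0. For m, η ∈ ℝ^d \ {0} define the d×d matrix A_m(η) := |η|^{−2s} ( |P⊥_m η|² I + (d−1) η ηᵀ − 2 P⊥_m η ηᵀ ), and for n ∈ ℝ^d \ {0} define 𝕂(n) := ∫_{ℝ^d} ⟨n−k⟩^{−d−2α} ( φ(k) A_{n−k}(k) − φ(n) A_{n−k}(n) ) dk. Then there exists a constant C depending only on d, s, α, C₀ such that for every n ∈ ℝ^d \ {0}, the matrix operator norm satisfies |𝕂(n)| ≤ C |n|^{−2s+2−2α}. -/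
open MeasureTheory
open scoped RealInnerProductSpace

noncomputable section

/-- The Japanese bracket `⟨x⟩ = (1+|x|²)^{1/2}`. -/
def jap {d : ℕ} (x : EuclideanSpace ℝ (Fin d)) : ℝ := Real.sqrt (1 + ‖x‖^2)

/-- The orthogonal projection `P⊥_k x = x − (k·x/|k|²) k` (junk value: identity at `k = 0`). -/
def Pperp {d : ℕ} (k x : EuclideanSpace ℝ (Fin d)) : EuclideanSpace ℝ (Fin d) :=
  x - (⟪k, x⟫ / ‖k‖^2) • k

/-- The matrix `A_m(η) = |η|^{−2s} (|P⊥_m η|² I + (d−1) ηηᵀ − 2 P⊥_m η ηᵀ)`. -/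
def Amat (d : ℕ) (s : ℝ) (m η : EuclideanSpace ℝ (Fin d)) : Matrix (Fin d) (Fin d) ℝ :=
  Matrix.of fun i j =>
    ‖η‖ ^ (-(2*s)) * (‖Pperp m η‖^2 * (if i = j then (1:ℝ) else 0)
      + ((d : ℝ) - 1) * (η i * η j) - 2 * (Pperp m η i * η j))

/-- The cut-off matrix integral `𝕂(n)`. -/
def Kmat (d : ℕ) (s α : ℝ) (φ : EuclideanSpace ℝ (Fin d) → ℝ)
    (n : EuclideanSpace ℝ (Fin d)) : Matrix (Fin d) (Fin d) ℝ :=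
  Matrix.of fun i j => ∫ k : EuclideanSpace ℝ (Fin d),
    jap (n - k) ^ (-(d : ℝ) - 2*α)
      * (φ k * Amat d s (n - k) k i j - φ n * Amat d s (n - k) n i j)

/-- Bounds on the values `x, y, z` of a function at `-1, 0, 1` and on their first and second
differences: `B` controls the values, and each difference gains a factor `ε`. -/
def SecondDiffBound (ε B x y z : ℝ) : Prop :=
  (|x| ≤ B ∧ |y| ≤ B ∧ |z| ≤ B) ∧ (|x - y| ≤ B * ε ∧ |z - y| ≤ B * ε) ∧
    |x + z - 2 * y| ≤ B * ε ^ 2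

namespace SecondDiffBound

lemma nonneg {ε B x y z : ℝ} (h : SecondDiffBound ε B x y z) : 0 ≤ B :=
  (abs_nonneg _).trans h.1.1

lemma const {ε B c : ℝ} (hε : 0 ≤ ε) (hc : |c| ≤ B) : SecondDiffBound ε B c c c := by
  have hB : 0 ≤ B := (abs_nonneg _).trans hc
  have h : c + c - 2 * c = 0 := by ring
  refine ⟨⟨hc, hc, hc⟩, ⟨?_, ?_⟩, ?_⟩
  · simpa using mul_nonneg hB hε
  · simpa using mul_nonneg hB hε
  · rw [h, abs_zero]; positivity

lemma add {ε B B' x y z x' y' z' : ℝ} (h : SecondDiffBound ε B x y z)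
    (h' : SecondDiffBound ε B' x' y' z') :
    SecondDiffBound ε (B + B') (x + x') (y + y') (z + z') := by
  obtain ⟨⟨h1, h2, h3⟩, ⟨h4, h5⟩, h6⟩ := h
  obtain ⟨⟨k1, k2, k3⟩, ⟨k4, k5⟩, k6⟩ := h'
  simp only [SecondDiffBound, abs_le] at *
  exact ⟨⟨by constructor <;> linarith, by constructor <;> linarith, by constructor <;> linarith⟩,
    ⟨by constructor <;> linarith, by constructor <;> linarith⟩, by constructor <;> linarith⟩

lemma mul {ε B B' x y z x' y' z' : ℝ} (hε : 0 ≤ ε) (h : SecondDiffBound ε B x y z)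
    (h' : SecondDiffBound ε B' x' y' z') :
    SecondDiffBound ε (4 * B * B') (x * x') (y * y') (z * z') := by
  have hB := h.nonneg
  have hB' := h'.nonneg
  obtain ⟨⟨h1, h2, h3⟩, ⟨h4, h5⟩, h6⟩ := h
  obtain ⟨⟨k1, k2, k3⟩, ⟨k4, k5⟩, k6⟩ := h'
  have key : ∀ {a b A A' : ℝ}, |a| ≤ A → |b| ≤ A' → |a * b| ≤ A * A' := fun ha hb => by
    rw [abs_mul]
    exact mul_le_mul ha hb (abs_nonneg _) ((abs_nonneg _).trans ha)
  have hBB : 0 ≤ B * B' := mul_nonneg hB hB'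
  have e1 : x * x' - y * y' = x * (x' - y') + (x - y) * y' := by ring
  have e2 : z * z' - y * y' = z * (z' - y') + (z - y) * y' := by ring
  have e3 : x * x' + z * z' - 2 * (y * y') = y * (x' + z' - 2 * y') + (x + z - 2 * y) * y'
    + ((x - y) * (x' - y') + (z - y) * (z' - y')) := by ring
  have hBBε : 0 ≤ B * B' * ε := mul_nonneg hBB hε
  refine ⟨⟨?_, ?_, ?_⟩, ⟨?_, ?_⟩, ?_⟩
  · linarith [key h1 k1]
  · linarith [key h2 k2]
  · linarith [key h3 k3]
  · rw [e1]
    linarith [abs_add_le (x * (x' - y')) ((x - y) * y'), key h1 k4, key h4 k2]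
  · rw [e2]
    linarith [abs_add_le (z * (z' - y')) ((z - y) * y'), key h3 k5, key h5 k2]
  · rw [e3]
    have := abs_add_three (y * (x' + z' - 2 * y')) ((x + z - 2 * y) * y')
      ((x - y) * (x' - y') + (z - y) * (z' - y'))
    have := abs_add_le ((x - y) * (x' - y')) ((z - y) * (z' - y'))
    linarith [key h2 k6, key h6 k2, key h4 k4, key h5 k5]

lemma of_hasDerivAt {ε B : ℝ} {g g' g'' : ℝ → ℝ} (hε : 0 ≤ ε)
    (hg : ∀ t ∈ Set.Icc (-1 : ℝ) 1, HasDerivAt g (g' t) t)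
    (hg' : ∀ t ∈ Set.Icc (-1 : ℝ) 1, HasDerivAt g' (g'' t) t)
    (b0 : ∀ t ∈ Set.Icc (-1 : ℝ) 1, |g t| ≤ B)
    (b1 : ∀ t ∈ Set.Icc (-1 : ℝ) 1, |g' t| ≤ B * ε)
    (b2 : ∀ t ∈ Set.Icc (-1 : ℝ) 1, |g'' t| ≤ B * ε ^ 2) :
    SecondDiffBound ε (2 * B) (g (-1)) (g 0) (g 1) := by
  have m1 : (-1 : ℝ) ∈ Set.Icc (-1 : ℝ) 1 := by simp
  have m0 : (0 : ℝ) ∈ Set.Icc (-1 : ℝ) 1 := by simp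
  have m2 : (1 : ℝ) ∈ Set.Icc (-1 : ℝ) 1 := by simp
  have hB : 0 ≤ B := (abs_nonneg _).trans (b0 0 m0)
  have hBε := mul_nonneg hB hε
  have mvt : ∀ {f f' : ℝ → ℝ} {C : ℝ}, (∀ t ∈ Set.Icc (-1 : ℝ) 1, HasDerivAt f (f' t) t) →
      (∀ t ∈ Set.Icc (-1 : ℝ) 1, |f' t| ≤ C) → ∀ x ∈ Set.Icc (-1 : ℝ) 1,
      ∀ y ∈ Set.Icc (-1 : ℝ) 1, |f y - f x| ≤ C * |y - x| := fun hf hb x hx y hy =>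
    (convex_Icc (-1 : ℝ) 1).norm_image_sub_le_of_norm_hasDerivWithin_le
      (fun t ht => (hf t ht).hasDerivWithinAt) hb hx hy
  have hneg : ∀ t ∈ Set.Icc (-1 : ℝ) 1, -t ∈ Set.Icc (-1 : ℝ) 1 := fun t ht =>
    ⟨by linarith [ht.2], by linarith [ht.1]⟩
  have hsym : ∀ t ∈ Set.Icc (-1 : ℝ) 1,
      HasDerivAt (fun t => g t + g (-t)) (g' t - g' (-t)) t := fun t ht =>
    ((hg t ht).add ((hg (-t) (hneg t ht)).scomp t (hasDerivAt_neg t))).congr_deriv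
      (by simp [sub_eq_add_neg])
  have hbd : ∀ t ∈ Set.Icc (-1 : ℝ) 1, |g' t - g' (-t)| ≤ 2 * B * ε ^ 2 := fun t ht => by
    refine (mvt hg' b2 _ (hneg t ht) _ ht).trans ?_
    have h2 : |t - -t| ≤ 2 := by
      rw [abs_le]; constructor <;> linarith [ht.1, ht.2]
    nlinarith [mul_nonneg hB (sq_nonneg ε)]
  refine ⟨⟨?_, ?_, ?_⟩, ⟨?_, ?_⟩, ?_⟩
  · linarith [b0 _ m1]
  · linarith [b0 _ m0]
  · linarith [b0 _ m2]
  · have := mvt hg b1 _ m0 _ m1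
    norm_num at this
    linarith
  · have := mvt hg b1 _ m0 _ m2
    norm_num at this
    linarith
  · have := mvt hsym hbd 0 m0 1 m2
    simp only [neg_zero, sub_zero, abs_one, mul_one] at this
    rwa [show g (-1) + g 1 - 2 * g 0 = g 1 + g (-1) - (g 0 + g 0) by ring]

end SecondDiffBound

lemma norm_Pperp_le {d : ℕ} (m x : EuclideanSpace ℝ (Fin d)) : ‖Pperp m x‖ ≤ ‖x‖ := by
  rcases eq_or_ne m 0 with rfl | hm
  · simp [Pperp]
  · have hm' : 0 < ‖m‖ ^ 2 := by positivity
    refine abs_le_of_sq_le_sq' ?_ (norm_nonneg _) |>.2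
    rw [Pperp, norm_sub_sq_real, norm_smul, inner_smul_right, real_inner_comm m x, mul_pow,
      Real.norm_eq_abs, sq_abs]
    have : (⟪m, x⟫ / ‖m‖ ^ 2) ^ 2 * ‖m‖ ^ 2 = ⟪m, x⟫ / ‖m‖ ^ 2 * ⟪m, x⟫ := by
      field_simp
    have h2 : 0 ≤ ⟪m, x⟫ / ‖m‖ ^ 2 * ⟪m, x⟫ := by
      rw [← this]; positivity
    linarith

lemma Pperp_neg_left {d : ℕ} (m x : EuclideanSpace ℝ (Fin d)) : Pperp (-m) x = Pperp m x := by
  simp [Pperp, neg_div]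

lemma Pperp_add_smul {d : ℕ} {m : EuclideanSpace ℝ (Fin d)} (hm : m ≠ 0)
    (x : EuclideanSpace ℝ (Fin d)) (t : ℝ) : Pperp m (x + t • m) = Pperp m x := by
  have hm' : ‖m‖ ^ 2 ≠ 0 := by positivity
  simp only [Pperp, inner_add_right, inner_smul_right, real_inner_self_eq_norm_sq, add_div,
    mul_div_assoc, div_self hm', mul_one, add_smul]
  abel

lemma Amat_neg_left (d : ℕ) (s : ℝ) (m η : EuclideanSpace ℝ (Fin d)) :
    Amat d s (-m) η = Amat d s m η := by
  simp [Amat, Pperp_neg_left]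

lemma abs_Amat_le (d : ℕ) (hd : 1 ≤ d) (s : ℝ) (m η : EuclideanSpace ℝ (Fin d)) (i j : Fin d) :
    |Amat d s m η i j| ≤ (d + 2) * ‖η‖ ^ (2 - 2 * s) := by
  rcases eq_or_ne η 0 with rfl | hη
  · have : Amat d s m 0 i j = 0 := by simp [Amat, Pperp]
    rw [this, abs_zero]
    positivity
  have hη' : 0 < ‖η‖ := norm_pos_iff.2 hη
  have hd' : (1 : ℝ) ≤ d := by exact_mod_cast hd
  have hp := norm_Pperp_le m η
  have hpi : |Pperp m η i| ≤ ‖η‖ := (PiLp.norm_apply_le (Pperp m η) i).trans hp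
  have hi : |η i| ≤ ‖η‖ := PiLp.norm_apply_le η i
  have hj : |η j| ≤ ‖η‖ := PiLp.norm_apply_le η j
  have key : ∀ {a b : ℝ}, |a| ≤ ‖η‖ → |b| ≤ ‖η‖ → |a * b| ≤ ‖η‖ ^ 2 := fun ha hb => by
    rw [abs_mul, sq]
    exact mul_le_mul ha hb (abs_nonneg _) (norm_nonneg _)
  have h1 : |‖Pperp m η‖ ^ 2 * (if i = j then (1 : ℝ) else 0)| ≤ ‖η‖ ^ 2 := by
    have := pow_le_pow_left₀ (norm_nonneg _) hp 2
    split_ifs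
    · simpa using this
    · simp
  have h2 : |((d : ℝ) - 1) * (η i * η j)| ≤ (d - 1) * ‖η‖ ^ 2 := by
    rw [abs_mul, abs_of_nonneg (sub_nonneg.2 hd')]
    exact mul_le_mul_of_nonneg_left (key hi hj) (sub_nonneg.2 hd')
  have h3 : |2 * (Pperp m η i * η j)| ≤ 2 * ‖η‖ ^ 2 := by
    rw [abs_mul, abs_two]
    exact mul_le_mul_of_nonneg_left (key hpi hj) zero_le_two
  have h4 : ‖η‖ ^ (2 - 2 * s) = ‖η‖ ^ (-(2 * s)) * ‖η‖ ^ 2 := by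
    rw [← Real.rpow_natCast, ← Real.rpow_add hη']
    congr 1; push_cast; ring
  rw [Amat, Matrix.of_apply, abs_mul, abs_of_nonneg (by positivity), h4]
  rw [show (d + 2 : ℝ) * (‖η‖ ^ (-(2 * s)) * ‖η‖ ^ 2)
    = ‖η‖ ^ (-(2 * s)) * ((d + 2 : ℝ) * ‖η‖ ^ 2) by ring]
  gcongr
  have := abs_sub (‖Pperp m η‖ ^ 2 * (if i = j then (1 : ℝ) else 0)
    + ((d : ℝ) - 1) * (η i * η j)) (2 * (Pperp m η i * η j))
  have := abs_add_le (‖Pperp m η‖ ^ 2 * (if i = j then (1 : ℝ) else 0))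
    (((d : ℝ) - 1) * (η i * η j))
  linarith

lemma jap_rpow_le {d : ℕ} {m : EuclideanSpace ℝ (Fin d)} (hm : m ≠ 0) {e : ℝ} (he : e ≤ 0) :
    jap m ^ e ≤ ‖m‖ ^ e := by
  refine Real.rpow_le_rpow_of_nonpos (norm_pos_iff.2 hm) ?_ he
  exact Real.le_sqrt_of_sq_le (by linarith)

lemma norm_add_smul_mem {E : Type*} [NormedAddCommGroup E] [NormedSpace ℝ E] {n m : E}
    (hm : ‖m‖ ≤ ‖n‖ / 2) {t : ℝ} (ht : t ∈ Set.Icc (-1 : ℝ) 1) :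
    ‖n‖ / 2 ≤ ‖n + t • m‖ ∧ ‖n + t • m‖ ≤ 3 / 2 * ‖n‖ := by
  have h : ‖t • m‖ ≤ ‖n‖ / 2 := by
    rw [norm_smul, Real.norm_eq_abs]
    exact (mul_le_of_le_one_left (norm_nonneg _) (abs_le.2 ht)).trans hm
  constructor
  · have := norm_sub_le (n + t • m) (t • m)
    rw [add_sub_cancel_right] at this
    linarith
  · linarith [norm_add_le n (t • m)]

lemma hasDerivAt_add_smul {E : Type*} [NormedAddCommGroup E] [NormedSpace ℝ E] (n m : E) (t : ℝ) :
    HasDerivAt (fun t : ℝ => n + t • m) m t := by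
  simpa using ((hasDerivAt_id t).smul_const m).const_add n

lemma secondDiffBound_cutoff {E : Type*} [NormedAddCommGroup E] [NormedSpace ℝ E] {φ : E → ℝ}
    {C₀ : ℝ} (hC₀ : 0 ≤ C₀) (hφ : ContDiff ℝ 2 φ) (h0 : ∀ n, 0 ≤ φ n ∧ φ n ≤ 1)
    (h1 : ∀ n, n ≠ 0 → ‖iteratedFDeriv ℝ 1 φ n‖ ≤ C₀ * ‖n‖ ^ (-1 : ℝ))
    (h2 : ∀ n, n ≠ 0 → ‖iteratedFDeriv ℝ 2 φ n‖ ≤ C₀ * ‖n‖ ^ (-2 : ℝ))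
    {n m : E} (hn : n ≠ 0) (hm : ‖m‖ ≤ ‖n‖ / 2) :
    SecondDiffBound (‖m‖ / ‖n‖) (2 * (1 + 4 * C₀)) (φ (n - m)) (φ n) (φ (n + m)) := by
  have hn' : 0 < ‖n‖ := norm_pos_iff.2 hn
  have hφ1 : ContDiff ℝ 1 (fderiv ℝ φ) := hφ.fderiv_right (by norm_num)
  have hpos : ∀ t ∈ Set.Icc (-1 : ℝ) 1, 0 < ‖n + t • m‖ := fun t ht =>
    (half_pos hn').trans_le (norm_add_smul_mem hm ht).1
  have hinv : ∀ t ∈ Set.Icc (-1 : ℝ) 1, ‖n + t • m‖⁻¹ ≤ 2 / ‖n‖ := fun t ht => by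
    rw [← inv_div]
    exact inv_anti₀ (half_pos hn') (norm_add_smul_mem hm ht).1
  have key := SecondDiffBound.of_hasDerivAt (ε := ‖m‖ / ‖n‖) (B := 1 + 4 * C₀)
    (g := fun t : ℝ => φ (n + t • m)) (g' := fun t => fderiv ℝ φ (n + t • m) m)
    (g'' := fun t => fderiv ℝ (fderiv ℝ φ) (n + t • m) m m) (by positivity)
    (fun t _ => ((hφ.differentiable (by norm_num)).differentiableAt.hasFDerivAt).comp_hasDerivAt t
      (hasDerivAt_add_smul n m t))
    (fun t _ => ((((hφ1.differentiable (by norm_num)).differentiableAt.hasFDerivAt).comp_hasDerivAt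
      t (hasDerivAt_add_smul n m t)).clm_apply (hasDerivAt_const t m)).congr_deriv (by simp))
    (fun t _ => by
      rw [abs_of_nonneg (h0 _).1]
      linarith [(h0 (n + t • m)).2])
    (fun t ht => by
      have hk := h1 _ (norm_pos_iff.1 (hpos t ht))
      rw [norm_iteratedFDeriv_one, Real.rpow_neg_one] at hk
      calc |fderiv ℝ φ (n + t • m) m| ≤ ‖fderiv ℝ φ (n + t • m)‖ * ‖m‖ := by
            rw [← Real.norm_eq_abs]; exact ContinuousLinearMap.le_opNorm _ _
        _ ≤ (C₀ * (2 / ‖n‖)) * ‖m‖ := by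
            gcongr
            exact hk.trans (by gcongr; exact hinv t ht)
        _ = (2 * C₀) * (‖m‖ / ‖n‖) := by ring
        _ ≤ (1 + 4 * C₀) * (‖m‖ / ‖n‖) := by gcongr; linarith)
    (fun t ht => by
      have hk := h2 _ (norm_pos_iff.1 (hpos t ht))
      rw [← norm_iteratedFDeriv_fderiv (n := 1), norm_iteratedFDeriv_one,
        Real.rpow_neg (norm_nonneg _), Real.rpow_two, ← inv_pow] at hk
      calc |fderiv ℝ (fderiv ℝ φ) (n + t • m) m m|
          ≤ ‖fderiv ℝ (fderiv ℝ φ) (n + t • m)‖ * ‖m‖ * ‖m‖ := by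
            rw [← Real.norm_eq_abs]; exact ContinuousLinearMap.le_opNorm₂ _ _ _
        _ ≤ (C₀ * (2 / ‖n‖) ^ 2) * ‖m‖ * ‖m‖ := by
            gcongr
            exact hk.trans (by gcongr; exact hinv t ht)
        _ = (4 * C₀) * (‖m‖ / ‖n‖) ^ 2 := by ring
        _ ≤ (1 + 4 * C₀) * (‖m‖ / ‖n‖) ^ 2 := by gcongr; linarith)
  simpa [sub_eq_add_neg] using key

lemma secondDiffBound_norm_rpow {E : Type*} [NormedAddCommGroup E] [InnerProductSpace ℝ E]
    {s : ℝ} (hs : 0 ≤ s) {n m : E} (hn : n ≠ 0) (hm : ‖m‖ ≤ ‖n‖ / 2) :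
    SecondDiffBound (‖m‖ / ‖n‖) (2 * ((1 + 24 * s + 144 * s * (s + 1)) *
      ((1 / 2) ^ (-(2 * s)) * ‖n‖ ^ (-(2 * s)))))
      (‖n - m‖ ^ (-(2 * s))) (‖n‖ ^ (-(2 * s))) (‖n + m‖ ^ (-(2 * s))) := by
  have hn' : 0 < ‖n‖ := norm_pos_iff.2 hn
  set Q : ℝ → ℝ := fun t => ‖n + t • m‖ ^ 2 with hQ
  set Q' : ℝ → ℝ := fun t => 2 * ⟪n + t • m, m⟫ with hQ'
  have dQ : ∀ t, HasDerivAt Q (Q' t) t := fun t => (hasDerivAt_add_smul n m t).norm_sq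
  have dQ' : ∀ t, HasDerivAt Q' (2 * ‖m‖ ^ 2) t := fun t => by
    refine (((hasDerivAt_add_smul n m t).inner ℝ (hasDerivAt_const t m)).const_mul 2).congr_deriv ?_
    simp
  have hQpos : ∀ t ∈ Set.Icc (-1 : ℝ) 1, 0 < Q t := fun t ht => by
    have := (half_pos hn').trans_le (norm_add_smul_mem hm ht).1
    positivity
  have hQinv : ∀ t ∈ Set.Icc (-1 : ℝ) 1, (Q t)⁻¹ ≤ 4 / ‖n‖ ^ 2 := fun t ht => by
    rw [← inv_div]
    refine inv_anti₀ (by positivity) ?_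
    have := pow_le_pow_left₀ (half_pos hn').le (norm_add_smul_mem hm ht).1 2
    simp only [hQ]; linarith
  have hQ'le : ∀ t ∈ Set.Icc (-1 : ℝ) 1, |Q' t| ≤ 3 * ‖n‖ * ‖m‖ := fun t ht => by
    simp only [hQ', abs_mul, abs_two]
    have := abs_real_inner_le_norm (n + t • m) m
    have := mul_le_mul_of_nonneg_right (norm_add_smul_mem hm ht).2 (norm_nonneg m)
    linarith
  have hQs : ∀ t, Q t ^ (-s) = ‖n + t • m‖ ^ (-(2 * s)) := fun t => by
    simp only [hQ]
    rw [← Real.rpow_natCast, ← Real.rpow_mul (norm_nonneg _)]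
    congr 1; push_cast; ring
  set R : ℝ := (1 / 2) ^ (-(2 * s)) * ‖n‖ ^ (-(2 * s)) with hR
  have hR0 : 0 ≤ R := by positivity
  have hQR : ∀ t ∈ Set.Icc (-1 : ℝ) 1, Q t ^ (-s) ≤ R := fun t ht => by
    rw [hQs, hR, ← Real.mul_rpow (by norm_num) hn'.le]
    refine Real.rpow_le_rpow_of_nonpos (by positivity) ?_ (by linarith)
    linarith [(norm_add_smul_mem hm ht).1]
  have hs1 : ∀ t ∈ Set.Icc (-1 : ℝ) 1, Q t ^ (-s - 1) ≤ R * (4 / ‖n‖ ^ 2) := fun t ht => by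
    rw [Real.rpow_sub_one (hQpos t ht).ne', div_eq_mul_inv]
    exact mul_le_mul (hQR t ht) (hQinv t ht) (inv_nonneg.2 (hQpos t ht).le) hR0
  have hs2 : ∀ t ∈ Set.Icc (-1 : ℝ) 1, Q t ^ (-s - 1 - 1) ≤ R * (4 / ‖n‖ ^ 2) * (4 / ‖n‖ ^ 2) :=
    fun t ht => by
    rw [Real.rpow_sub_one (hQpos t ht).ne', div_eq_mul_inv]
    exact mul_le_mul (hs1 t ht) (hQinv t ht) (inv_nonneg.2 (hQpos t ht).le) (by positivity)
  have e2 : ∀ (q : ℝ) {p : ℝ}, 0 ≤ p →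
      |q * (-s) * (q * (-s - 1) * p)| = |q| * s * (|q| * (s + 1) * p) := fun q p hp => by
    have h : |-s - 1| = s + 1 := by rw [abs_of_nonpos (by linarith)]; ring
    rw [abs_mul, abs_mul, abs_mul, abs_mul, abs_neg, h, abs_of_nonneg hs, abs_of_nonneg hp]
  have key := SecondDiffBound.of_hasDerivAt (ε := ‖m‖ / ‖n‖)
    (B := (1 + 24 * s + 144 * s * (s + 1)) * R)
    (g := fun t => Q t ^ (-s)) (g' := fun t => Q' t * (-s) * Q t ^ (-s - 1))
    (g'' := fun t => 2 * ‖m‖ ^ 2 * (-s) * Q t ^ (-s - 1)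
      + Q' t * (-s) * (Q' t * (-s - 1) * Q t ^ (-s - 1 - 1))) (by positivity)
    (fun t ht => (dQ t).rpow_const (Or.inl (hQpos t ht).ne'))
    (fun t ht => ((dQ' t).mul_const (-s)).mul ((dQ t).rpow_const (Or.inl (hQpos t ht).ne')))
    (fun t ht => by
      rw [abs_of_nonneg (Real.rpow_nonneg (hQpos t ht).le _)]
      refine (hQR t ht).trans (le_mul_of_one_le_left hR0 ?_)
      have : 0 ≤ s * (s + 1) := by positivity
      linarith)
    (fun t ht => by
      rw [abs_mul, abs_mul, abs_neg, abs_of_nonneg hs,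
        abs_of_nonneg (Real.rpow_nonneg (hQpos t ht).le _)]
      calc |Q' t| * s * Q t ^ (-s - 1) ≤ 3 * ‖n‖ * ‖m‖ * s * (R * (4 / ‖n‖ ^ 2)) := by
            gcongr
            · exact hQ'le t ht
            · exact hs1 t ht
        _ = (12 * s) * R * (‖m‖ / ‖n‖) := by field_simp; ring
        _ ≤ (1 + 24 * s + 144 * s * (s + 1)) * R * (‖m‖ / ‖n‖) := by
            gcongr
            have : 0 ≤ s * (s + 1) := by positivity
            linarith)
    (fun t ht => by
      have hp1 := Real.rpow_nonneg (hQpos t ht).le (-s - 1)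
      have hp2 := Real.rpow_nonneg (hQpos t ht).le (-s - 1 - 1)
      have e1 : |2 * ‖m‖ ^ 2 * (-s) * Q t ^ (-s - 1)| = 2 * ‖m‖ ^ 2 * s * Q t ^ (-s - 1) := by
        rw [abs_mul, abs_mul, abs_neg, abs_of_nonneg hs, abs_of_nonneg hp1,
          abs_of_nonneg (by positivity)]
      calc |2 * ‖m‖ ^ 2 * (-s) * Q t ^ (-s - 1)
            + Q' t * (-s) * (Q' t * (-s - 1) * Q t ^ (-s - 1 - 1))|
          ≤ 2 * ‖m‖ ^ 2 * s * Q t ^ (-s - 1)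
            + |Q' t| * s * (|Q' t| * (s + 1) * Q t ^ (-s - 1 - 1)) := by
            rw [← e1, ← e2 _ hp2]; exact abs_add_le _ _
        _ ≤ 2 * ‖m‖ ^ 2 * s * (R * (4 / ‖n‖ ^ 2))
            + 3 * ‖n‖ * ‖m‖ * s * (3 * ‖n‖ * ‖m‖ * (s + 1) *
              (R * (4 / ‖n‖ ^ 2) * (4 / ‖n‖ ^ 2))) := by
            gcongr
            · exact hs1 t ht
            · exact hQ'le t ht
            · exact hQ'le t ht
            · exact hs2 t ht
        _ = (8 * s + 144 * s * (s + 1)) * R * (‖m‖ / ‖n‖) ^ 2 := by field_simp; ring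
        _ ≤ (1 + 24 * s + 144 * s * (s + 1)) * R * (‖m‖ / ‖n‖) ^ 2 := by
            gcongr
            linarith)
  simp only [hQs] at key
  simpa [sub_eq_add_neg] using key

lemma secondDiffBound_coord {d : ℕ} {n m : EuclideanSpace ℝ (Fin d)} (hn : n ≠ 0)
    (hm : ‖m‖ ≤ ‖n‖ / 2) (i : Fin d) :
    SecondDiffBound (‖m‖ / ‖n‖) (2 * ‖n‖) ((n - m) i) (n i) ((n + m) i) := by
  have hn' : 0 < ‖n‖ := norm_pos_iff.2 hn
  have hni : |n i| ≤ ‖n‖ := PiLp.norm_apply_le n i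
  have hmi : |m i| ≤ ‖m‖ := PiLp.norm_apply_le m i
  have e : 2 * ‖n‖ * (‖m‖ / ‖n‖) = 2 * ‖m‖ := by field_simp
  have hnn := norm_nonneg m
  simp only [PiLp.sub_apply, PiLp.add_apply]
  refine ⟨⟨?_, ?_, ?_⟩, ⟨?_, ?_⟩, ?_⟩
  · linarith [abs_sub (n i) (m i)]
  · linarith
  · linarith [abs_add_le (n i) (m i)]
  · rw [e, show n i - m i - n i = -(m i) by ring, abs_neg]; linarith
  · rw [e, add_sub_cancel_left]; linarith
  · rw [show n i - m i + (n i + m i) - 2 * n i = 0 by ring, abs_zero]; positivity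

/-- The constant in the second difference bound for `φ A_m` along a segment in direction `m`. -/
def nearConst (d : ℕ) (s C₀ : ℝ) : ℝ :=
  4 * (2 * (1 + 4 * C₀)) * (4 * (2 * ((1 + 24 * s + 144 * s * (s + 1)) * (1 / 2) ^ (-(2 * s))))
    * (1 + 16 * (4 * d) + 4 * 2 * (4 * 2)))

lemma near_bound {d : ℕ} (hd : 1 ≤ d) {s C₀ : ℝ} (hs : 0 ≤ s) (hC₀ : 0 ≤ C₀)
    {φ : EuclideanSpace ℝ (Fin d) → ℝ} (hφ : ContDiff ℝ 2 φ) (h0 : ∀ n, 0 ≤ φ n ∧ φ n ≤ 1)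
    (h1 : ∀ n, n ≠ 0 → ‖iteratedFDeriv ℝ 1 φ n‖ ≤ C₀ * ‖n‖ ^ (-1 : ℝ))
    (h2 : ∀ n, n ≠ 0 → ‖iteratedFDeriv ℝ 2 φ n‖ ≤ C₀ * ‖n‖ ^ (-2 : ℝ))
    {n m : EuclideanSpace ℝ (Fin d)} (hn : n ≠ 0) (hm0 : m ≠ 0) (hm : ‖m‖ ≤ ‖n‖ / 2)
    (i j : Fin d) :
    |φ (n - m) * Amat d s m (n - m) i j + φ (n + m) * Amat d s m (n + m) i j
      - 2 * (φ n * Amat d s m n i j)|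
      ≤ nearConst d s C₀ * ‖n‖ ^ (2 - 2 * s) * (‖m‖ / ‖n‖) ^ 2 := by
  have hn' : 0 < ‖n‖ := norm_pos_iff.2 hn
  have hε : 0 ≤ ‖m‖ / ‖n‖ := by positivity
  have hd' : (1 : ℝ) ≤ d := by exact_mod_cast hd
  have hp1 : Pperp m (n - m) = Pperp m n := by
    simpa [sub_eq_add_neg] using Pperp_add_smul hm0 n (-1)
  have hp2 : Pperp m (n + m) = Pperp m n := by
    simpa using Pperp_add_smul hm0 n 1
  have hpn := norm_Pperp_le m n
  have hpi : |Pperp m n i| ≤ ‖n‖ := (PiLp.norm_apply_le (Pperp m n) i).trans hpn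
  have t1 : SecondDiffBound (‖m‖ / ‖n‖) (‖n‖ ^ 2)
      (‖Pperp m n‖ ^ 2 * (if i = j then (1 : ℝ) else 0))
      (‖Pperp m n‖ ^ 2 * (if i = j then (1 : ℝ) else 0))
      (‖Pperp m n‖ ^ 2 * (if i = j then (1 : ℝ) else 0)) := by
    refine SecondDiffBound.const hε ?_
    have := pow_le_pow_left₀ (norm_nonneg _) hpn 2
    split_ifs
    · simpa using this
    · simp
  have t2 := (SecondDiffBound.const (B := (d : ℝ)) (c := (d : ℝ) - 1) hε
    (abs_le.2 ⟨by linarith, by linarith⟩)).mul hε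
    ((secondDiffBound_coord hn hm i).mul hε (secondDiffBound_coord hn hm j))
  have t3 := (SecondDiffBound.const (B := 2) (c := -2) hε (by norm_num)).mul hε
    ((SecondDiffBound.const hε hpi).mul hε (secondDiffBound_coord hn hm j))
  have key := (secondDiffBound_cutoff hC₀ hφ h0 h1 h2 hn hm).mul hε
    ((secondDiffBound_norm_rpow hs hn hm).mul hε ((t1.add t2).add t3))
  have hfin := key.2.2
  simp only [Amat, Matrix.of_apply, hp1, hp2]
  have h4 : ‖n‖ ^ (2 - 2 * s) = ‖n‖ ^ (-(2 * s)) * ‖n‖ ^ 2 := by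
    rw [← Real.rpow_natCast, ← Real.rpow_add hn']
    congr 1; push_cast; ring
  rw [h4]
  convert hfin using 1
  · congr 1; ring
  · rw [nearConst]; ring

/-- The power `‖u‖ ^ r` cut off to the ball of radius `1 / 2`. -/
def ballPow {E : Type*} [NormedAddCommGroup E] (r : ℝ) : E → ℝ :=
  (Metric.ball (0 : E) (1 / 2)).indicator fun u => ‖u‖ ^ r

lemma ballPow_nonneg {E : Type*} [NormedAddCommGroup E] (r : ℝ) (u : E) : 0 ≤ ballPow r u :=
  Set.indicator_nonneg (fun _ _ => by positivity) _

lemma ballPow_of_lt {E : Type*} [NormedAddCommGroup E] (r : ℝ) {u : E} (hu : ‖u‖ < 1 / 2) :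
    ballPow r u = ‖u‖ ^ r :=
  Set.indicator_of_mem (mem_ball_zero_iff.2 hu) _

lemma integrable_ballPow {E : Type*} [NormedAddCommGroup E] [NormedSpace ℝ E]
    [FiniteDimensional ℝ E] [MeasurableSpace E] [BorelSpace E] (μ : Measure E)
    [μ.IsAddHaarMeasure] (hE : 1 ≤ Module.finrank ℝ E) {r : ℝ}
    (hr : -(Module.finrank ℝ E : ℝ) < r) : Integrable (ballPow r : E → ℝ) μ := by
  refine (integrable_indicator_iff measurableSet_ball).2 ?_
  refine integrableOn_ball_of_norm_le_rpow hE (C := 1) (α := -r) (by linarith) ?_ ?_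
  · refine Filter.Eventually.of_forall fun x => ?_
    rw [neg_neg, one_mul, Real.norm_of_nonneg (by positivity)]
  · exact (measurable_norm.pow_const r).aestronglyMeasurable

/-- The scale invariant majorant of the symmetrised integrand, with `a = d + 2α`, `σ = 2 - 2s` and
`w = n / ‖n‖`. -/
def majorant {E : Type*} [NormedAddCommGroup E] (a σ : ℝ) (w u : E) : ℝ :=
  ballPow (2 - a) u + (1 + ‖u‖) ^ (-a) + (ballPow σ (w - u) + ballPow σ (w + u))

/-- The integral of `majorant a σ w`, which does not depend on `w`. -/
def majorantMass {E : Type*} [NormedAddCommGroup E] [MeasurableSpace E] (μ : Measure E)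
    (a σ : ℝ) : ℝ :=
  (∫ u, ballPow (2 - a) u ∂μ) + (∫ u, (1 + ‖u‖) ^ (-a) ∂μ) + 2 * ∫ u, ballPow σ u ∂μ

lemma majorantMass_nonneg {E : Type*} [NormedAddCommGroup E] [MeasurableSpace E] (μ : Measure E)
    (a σ : ℝ) : 0 ≤ majorantMass μ a σ := by
  have b1 : 0 ≤ ∫ u, ballPow (2 - a) u ∂μ := integral_nonneg fun u => ballPow_nonneg _ u
  have b2 : 0 ≤ ∫ u, (1 + ‖u‖) ^ (-a) ∂μ := integral_nonneg fun u => by positivity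
  have b3 : 0 ≤ ∫ u, ballPow σ u ∂μ := integral_nonneg fun u => ballPow_nonneg _ u
  unfold majorantMass; positivity

lemma integrable_majorant {E : Type*} [NormedAddCommGroup E] [NormedSpace ℝ E]
    [FiniteDimensional ℝ E] [MeasurableSpace E] [BorelSpace E] (μ : Measure E)
    [μ.IsAddHaarMeasure] (hE : 1 ≤ Module.finrank ℝ E) {a σ : ℝ}
    (ha : (Module.finrank ℝ E : ℝ) < a) (ha2 : a < Module.finrank ℝ E + 2)
    (hσ : -(Module.finrank ℝ E : ℝ) < σ) (w : E) :
    Integrable (majorant a σ w) μ ∧ ∫ u, majorant a σ w u ∂μ = majorantMass μ a σ := by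
  have i1 : Integrable (ballPow (2 - a) : E → ℝ) μ := integrable_ballPow μ hE (by linarith)
  have i2 : Integrable (fun u : E => (1 + ‖u‖) ^ (-a)) μ := integrable_one_add_norm ha
  have i3 : Integrable (ballPow σ : E → ℝ) μ := integrable_ballPow μ hE hσ
  have i4 : Integrable (fun u : E => ballPow σ (w - u)) μ := i3.comp_sub_left w
  have i5 : Integrable (fun u : E => ballPow σ (w + u)) μ := i3.comp_add_left w
  refine ⟨(i1.add i2).add (i4.add i5), ?_⟩
  have e : ∫ u, majorant a σ w u ∂μ = ((∫ u, ballPow (2 - a) u ∂μ) + ∫ u, (1 + ‖u‖) ^ (-a) ∂μ) +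
      ((∫ u, ballPow σ (w - u) ∂μ) + ∫ u, ballPow σ (w + u) ∂μ) := by
    rw [← integral_add i1 i2, ← integral_add i4 i5]
    exact integral_add (i1.add i2) (i4.add i5)
  rw [e, integral_sub_left_eq_self (ballPow σ) μ w, integral_add_left_eq_self (ballPow σ) w,
    majorantMass]
  ring

lemma rpow_le_of_half_le {a t : ℝ} (ha : 0 ≤ a) (ht : 1 / 2 ≤ t) :
    t ^ (-a) ≤ (1 / 3) ^ (-a) * (1 + t) ^ (-a) := by
  rw [← Real.mul_rpow (by norm_num) (by linarith)]
  exact Real.rpow_le_rpow_of_nonpos (by linarith) (by linarith) (by linarith)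

lemma rpow_mul_norm_rpow_le {E : Type*} [NormedAddCommGroup E] {a σ t : ℝ} (ha : 0 ≤ a)
    (hσ : σ ≤ 0) (ht : 1 / 2 ≤ t) (w : E) :
    t ^ (-a) * ‖w‖ ^ σ ≤ (1 / 2) ^ (-a) * ballPow σ w
      + (1 / 2) ^ σ * ((1 / 3) ^ (-a) * (1 + t) ^ (-a)) := by
  have h1 : t ^ (-a) ≤ (1 / 2) ^ (-a) :=
    Real.rpow_le_rpow_of_nonpos (by norm_num) ht (by linarith)
  have h2 := rpow_le_of_half_le ha ht
  have h3 : 0 ≤ t ^ (-a) := Real.rpow_nonneg (by linarith) _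
  rcases lt_or_ge ‖w‖ (1 / 2) with hw | hw
  · rw [ballPow_of_lt σ hw]
    have : t ^ (-a) * ‖w‖ ^ σ ≤ (1 / 2) ^ (-a) * ‖w‖ ^ σ := by gcongr
    have : 0 ≤ (1 / 2 : ℝ) ^ σ * ((1 / 3) ^ (-a) * (1 + t) ^ (-a)) :=
      mul_nonneg (by positivity) (h3.trans h2)
    linarith
  · have hw' : ‖w‖ ^ σ ≤ (1 / 2) ^ σ := Real.rpow_le_rpow_of_nonpos (by norm_num) hw hσ
    have h4 : t ^ (-a) * ‖w‖ ^ σ ≤ ((1 / 3) ^ (-a) * (1 + t) ^ (-a)) * (1 / 2) ^ σ :=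
      mul_le_mul h2 hw' (by positivity) (h3.trans h2)
    have := mul_nonneg (by positivity : (0 : ℝ) ≤ (1 / 2) ^ (-a)) (ballPow_nonneg σ w)
    linarith

/-- The constant in the bound of the symmetrised integrand by `majorant`. -/
def pairConst (d : ℕ) (s a C₀ : ℝ) : ℝ :=
  nearConst d s C₀ + (d + 2) *
    ((1 / 2) ^ (-a) + 2 * (1 / 2) ^ (2 - 2 * s) * (1 / 3) ^ (-a) + 2 * (1 / 3) ^ (-a))

lemma nearConst_le_pairConst (d : ℕ) (s a C₀ : ℝ) : nearConst d s C₀ ≤ pairConst d s a C₀ :=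
  le_add_of_nonneg_right (by positivity)

lemma nearConst_nonneg (d : ℕ) {s C₀ : ℝ} (hs : 0 ≤ s) (hC₀ : 0 ≤ C₀) : 0 ≤ nearConst d s C₀ := by
  unfold nearConst; positivity

lemma pairConst_nonneg (d : ℕ) {s C₀ : ℝ} (a : ℝ) (hs : 0 ≤ s) (hC₀ : 0 ≤ C₀) :
    0 ≤ pairConst d s a C₀ := by
  have := nearConst_nonneg d hs hC₀
  unfold pairConst; positivity

lemma pair_bound {d : ℕ} (hd : 1 ≤ d) {s a C₀ : ℝ} (hs : 1 ≤ s) (ha : 0 ≤ a) (hC₀ : 0 ≤ C₀)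
    {φ : EuclideanSpace ℝ (Fin d) → ℝ} (hφ : ContDiff ℝ 2 φ) (h0 : ∀ n, 0 ≤ φ n ∧ φ n ≤ 1)
    (h1 : ∀ n, n ≠ 0 → ‖iteratedFDeriv ℝ 1 φ n‖ ≤ C₀ * ‖n‖ ^ (-1 : ℝ))
    (h2 : ∀ n, n ≠ 0 → ‖iteratedFDeriv ℝ 2 φ n‖ ≤ C₀ * ‖n‖ ^ (-2 : ℝ))
    {n u : EuclideanSpace ℝ (Fin d)} (hn : n ≠ 0) (hu : u ≠ 0) (i j : Fin d)
    {m : EuclideanSpace ℝ (Fin d)} (hmu : m = ‖n‖ • u) :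
    |jap m ^ (-a) * (φ (n - m) * Amat d s m (n - m) i j - φ n * Amat d s m n i j)
      + jap m ^ (-a) * (φ (n + m) * Amat d s m (n + m) i j - φ n * Amat d s m n i j)|
      ≤ pairConst d s a C₀ * ‖n‖ ^ (2 - 2 * s - a) * majorant a (2 - 2 * s) (‖n‖⁻¹ • n) u := by
  have hn' : 0 < ‖n‖ := norm_pos_iff.2 hn
  have hu' : 0 < ‖u‖ := norm_pos_iff.2 hu
  have hm0 : m ≠ 0 := by rw [hmu]; exact smul_ne_zero hn'.ne' hu
  have hmn : ‖m‖ = ‖n‖ * ‖u‖ := by rw [hmu, norm_smul, norm_norm]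
  have hs0 : 0 ≤ s := by linarith
  have hJ0 : 0 ≤ jap m ^ (-a) := Real.rpow_nonneg (Real.sqrt_nonneg _) _
  have hJ : jap m ^ (-a) ≤ ‖n‖ ^ (-a) * ‖u‖ ^ (-a) := by
    rw [← Real.mul_rpow hn'.le hu'.le, ← hmn]
    exact jap_rpow_le hm0 (by linarith)
  have hNa : ‖n‖ ^ (2 - 2 * s - a) = ‖n‖ ^ (-a) * ‖n‖ ^ (2 - 2 * s) := by
    rw [← Real.rpow_add hn']; congr 1; ring
  set N := ‖n‖ ^ (-a) * ‖n‖ ^ (2 - 2 * s) with hN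
  have hN0 : 0 ≤ N := by positivity
  set w := ‖n‖⁻¹ • n with hw
  have hnw : n = ‖n‖ • w := by rw [hw, smul_inv_smul₀ hn'.ne']
  have b1 := ballPow_nonneg (2 - a) u
  have b2 := ballPow_nonneg (2 - 2 * s) (w - u)
  have b3 := ballPow_nonneg (2 - 2 * s) (w + u)
  have b4 : 0 ≤ (1 + ‖u‖) ^ (-a) := by positivity
  have hnc := nearConst_nonneg d hs0 hC₀
  rw [hNa]
  rcases lt_or_ge ‖u‖ (1 / 2) with hlt | hge
  · have hk := near_bound hd hs0 hC₀ hφ h0 h1 h2 hn hm0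
      (by rw [hmn]; nlinarith) i j
    rw [hmn, mul_div_cancel_left₀ _ hn'.ne'] at hk
    rw [show ∀ J x y z : ℝ, J * (x - z) + J * (y - z) = J * (x + y - 2 * z) from
      fun J x y z => by ring, abs_mul, abs_of_nonneg hJ0]
    have hup : ‖u‖ ^ (2 - a) = ‖u‖ ^ (-a) * ‖u‖ ^ 2 := by
      rw [← Real.rpow_natCast, ← Real.rpow_add hu']
      congr 1; push_cast; ring
    have hM : ‖u‖ ^ (2 - a) ≤ majorant a (2 - 2 * s) w u := by
      rw [majorant, ballPow_of_lt _ hlt]; linarith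
    calc _ ≤ (‖n‖ ^ (-a) * ‖u‖ ^ (-a)) *
          (nearConst d s C₀ * ‖n‖ ^ (2 - 2 * s) * ‖u‖ ^ 2) := by gcongr
      _ = nearConst d s C₀ * N * ‖u‖ ^ (2 - a) := by rw [hup, hN]; ring
      _ ≤ pairConst d s a C₀ * N * majorant a (2 - 2 * s) w u := by
          have hle : nearConst d s C₀ * N ≤ pairConst d s a C₀ * N :=
            mul_le_mul_of_nonneg_right (nearConst_le_pairConst d s a C₀) hN0
          exact mul_le_mul hle hM (by positivity) ((mul_nonneg hnc hN0).trans hle)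
  · have hT : ∀ x : EuclideanSpace ℝ (Fin d),
        |φ (‖n‖ • x) * Amat d s m (‖n‖ • x) i j|
          ≤ (d + 2) * (‖n‖ ^ (2 - 2 * s) * ‖x‖ ^ (2 - 2 * s)) := fun x => by
      rw [abs_mul, abs_of_nonneg (h0 _).1]
      refine (mul_le_of_le_one_left (abs_nonneg _) (h0 _).2).trans ?_
      refine (abs_Amat_le d hd s m _ i j).trans (le_of_eq ?_)
      rw [norm_smul, norm_norm, Real.mul_rpow hn'.le (norm_nonneg _)]
    have hw1 : ‖w‖ = 1 := by
      rw [hw, norm_smul, norm_inv, norm_norm, inv_mul_cancel₀ hn'.ne']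
    have e1 := hT (w - u)
    have e2 := hT (w + u)
    have e3 := hT w
    rw [smul_sub, ← hnw, ← hmu] at e1
    rw [smul_add, ← hnw, ← hmu] at e2
    rw [← hnw, hw1, Real.one_rpow, mul_one] at e3
    have f1 := rpow_mul_norm_rpow_le ha (by linarith : 2 - 2 * s ≤ 0) hge (w - u)
    have f2 := rpow_mul_norm_rpow_le ha (by linarith : 2 - 2 * s ≤ 0) hge (w + u)
    have f3 := rpow_le_of_half_le ha hge
    have hs1 : |φ (n - m) * Amat d s m (n - m) i j - φ n * Amat d s m n i j
        + (φ (n + m) * Amat d s m (n + m) i j - φ n * Amat d s m n i j)|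
        ≤ (d + 2) * ‖n‖ ^ (2 - 2 * s) * (‖w - u‖ ^ (2 - 2 * s) + ‖w + u‖ ^ (2 - 2 * s) + 2) := by
      rw [abs_le] at *
      constructor <;> linarith
    rw [← mul_add, abs_mul, abs_of_nonneg hJ0]
    have c2 : (0 : ℝ) ≤ (1 / 2) ^ (-a) := by positivity
    have c3 : (0 : ℝ) ≤ (1 / 3) ^ (-a) := by positivity
    have cs : (0 : ℝ) ≤ (1 / 2) ^ (2 - 2 * s) := by positivity
    calc _ ≤ (‖n‖ ^ (-a) * ‖u‖ ^ (-a)) * ((d + 2) * ‖n‖ ^ (2 - 2 * s) *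
          (‖w - u‖ ^ (2 - 2 * s) + ‖w + u‖ ^ (2 - 2 * s) + 2)) := by gcongr
      _ = (d + 2) * N * (‖u‖ ^ (-a) * ‖w - u‖ ^ (2 - 2 * s)
          + ‖u‖ ^ (-a) * ‖w + u‖ ^ (2 - 2 * s) + 2 * ‖u‖ ^ (-a)) := by rw [hN]; ring
      _ ≤ (d + 2) * N * (((1 / 2) ^ (-a) + 2 * (1 / 2) ^ (2 - 2 * s) * (1 / 3) ^ (-a)
          + 2 * (1 / 3) ^ (-a)) * majorant a (2 - 2 * s) w u) := by
          gcongr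
          rw [majorant]
          nlinarith [mul_nonneg c2 b1, mul_nonneg c2 b4, mul_nonneg (mul_nonneg cs c3) b1,
            mul_nonneg (mul_nonneg cs c3) b2, mul_nonneg (mul_nonneg cs c3) b3,
            mul_nonneg c3 b1, mul_nonneg c3 b2, mul_nonneg c3 b3]
      _ ≤ pairConst d s a C₀ * N * majorant a (2 - 2 * s) w u := by
          have hM : 0 ≤ majorant a (2 - 2 * s) w u := by rw [majorant]; positivity
          have := mul_nonneg (mul_nonneg hnc hN0) hM
          rw [pairConst]
          linarith

lemma two_mul_integral_eq_integral_add_sub {G : Type*} [AddCommGroup G] [MeasurableSpace G]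
    [MeasurableAdd₂ G] [MeasurableNeg G] (μ : Measure G) [μ.IsAddLeftInvariant]
    [μ.IsNegInvariant] {f : G → ℝ} (hf : Integrable f μ) (n : G) :
    2 * ∫ k, f k ∂μ = ∫ m, (f (n - m) + f (n + m)) ∂μ := by
  rw [integral_add (hf.comp_sub_left n) (hf.comp_add_left n), integral_sub_left_eq_self f μ n,
    integral_add_left_eq_self f n]
  ring

lemma norm_toEuclideanCLM_le {d : ℕ} (M : Matrix (Fin d) (Fin d) ℝ) {B : ℝ} (hB : 0 ≤ B)
    (h : ∀ i j, |M i j| ≤ B) : ‖Matrix.toEuclideanCLM (𝕜 := ℝ) M‖ ≤ d * d * B := by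
  refine ContinuousLinearMap.opNorm_le_bound _ (by positivity) fun x => ?_
  have hi : ∀ i, |Matrix.toEuclideanCLM (𝕜 := ℝ) M x i| ≤ d * B * ‖x‖ := fun i => by
    rw [Matrix.ofLp_toEuclideanCLM, Matrix.mulVec, dotProduct]
    refine (Finset.abs_sum_le_sum_abs _ _).trans ?_
    refine (Finset.sum_le_sum (g := fun _ => B * ‖x‖) fun j _ => ?_).trans
      (le_of_eq (by simp [mul_assoc]))
    rw [abs_mul]
    exact mul_le_mul (h i j) (PiLp.norm_apply_le x j) (abs_nonneg _) hB
  set y := Matrix.toEuclideanCLM (𝕜 := ℝ) M x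
  have hy : y = ∑ i, y i • EuclideanSpace.single i (1 : ℝ) := by
    ext k
    simp [Pi.single_apply]
  rw [hy]
  refine (norm_sum_le _ _).trans ?_
  refine (Finset.sum_le_sum (g := fun _ => d * B * ‖x‖) fun i _ => ?_).trans
    (le_of_eq (by simp [mul_assoc]))
  rw [norm_smul, EuclideanSpace.single, PiLp.norm_single, norm_one, mul_one]
  exact hi i

lemma abs_Kmat_le {d : ℕ} (hd : 1 ≤ d) {s α C₀ : ℝ} (hs : 1 ≤ s) (hsd : s < (d : ℝ) / 2)
    (hα0 : 0 < α) (hα1 : α < 1) (hC₀ : 0 ≤ C₀)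
    {φ : EuclideanSpace ℝ (Fin d) → ℝ} (hφ : ContDiff ℝ 2 φ) (h0 : ∀ n, 0 ≤ φ n ∧ φ n ≤ 1)
    (h1 : ∀ n, n ≠ 0 → ‖iteratedFDeriv ℝ 1 φ n‖ ≤ C₀ * ‖n‖ ^ (-1 : ℝ))
    (h2 : ∀ n, n ≠ 0 → ‖iteratedFDeriv ℝ 2 φ n‖ ≤ C₀ * ‖n‖ ^ (-2 : ℝ))
    {n : EuclideanSpace ℝ (Fin d)} (hn : n ≠ 0) (i j : Fin d) :
    |Kmat d s α φ n i j| ≤ pairConst d s (d + 2 * α) C₀ *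
      majorantMass (volume : Measure (EuclideanSpace ℝ (Fin d))) (d + 2 * α) (2 - 2 * s) *
      ‖n‖ ^ (-(2 * s) + 2 - 2 * α) := by
  have hn' : 0 < ‖n‖ := norm_pos_iff.2 hn
  have hfr : Module.finrank ℝ (EuclideanSpace ℝ (Fin d)) = d := finrank_euclideanSpace_fin
  have : Nontrivial (EuclideanSpace ℝ (Fin d)) :=
    Module.nontrivial_of_finrank_pos (R := ℝ) (by rw [hfr]; exact hd)
  set a : ℝ := d + 2 * α with ha
  obtain ⟨hMi, hMe⟩ := integrable_majorant (volume : Measure (EuclideanSpace ℝ (Fin d)))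
    (a := a) (σ := 2 - 2 * s) (by rwa [hfr]) (by rw [hfr]; linarith) (by rw [hfr]; linarith)
    (by rw [hfr]; linarith) (‖n‖⁻¹ • n)
  rw [← hMe]
  have hM0 : 0 ≤ ∫ u, majorant a (2 - 2 * s) (‖n‖⁻¹ • n) u :=
    hMe ▸ majorantMass_nonneg volume a (2 - 2 * s)
  have hP := pairConst_nonneg d a (by linarith : 0 ≤ s) hC₀
  rw [Kmat, Matrix.of_apply]
  set f : EuclideanSpace ℝ (Fin d) → ℝ := fun k => jap (n - k) ^ (-(d : ℝ) - 2*α)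
      * (φ k * Amat d s (n - k) k i j - φ n * Amat d s (n - k) n i j) with hf
  by_cases hfi : Integrable f
  swap
  · rw [integral_undef hfi, abs_zero]
    positivity
  set g : EuclideanSpace ℝ (Fin d) → ℝ := fun m => f (n - m) + f (n + m) with hg
  have hgb : ∀ u : EuclideanSpace ℝ (Fin d), u ≠ 0 → ‖g (‖n‖ • u)‖ ≤
      pairConst d s a C₀ * ‖n‖ ^ (2 - 2 * s - a) * majorant a (2 - 2 * s) (‖n‖⁻¹ • n) u :=
    fun u hu => by
    have hjap : jap (-(‖n‖ • u)) = jap (‖n‖ • u) := by simp [jap]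
    have := pair_bound hd hs (by positivity : 0 ≤ a) hC₀ hφ h0 h1 h2 hn hu i j rfl
    simp only [hg, hf, sub_sub_cancel, sub_add_cancel_left, Amat_neg_left, hjap, Real.norm_eq_abs]
    rwa [show -(d : ℝ) - 2 * α = -a by rw [ha]; ring]
  have hint : |∫ u : EuclideanSpace ℝ (Fin d), g (‖n‖ • u)| ≤ pairConst d s a C₀ * ‖n‖ ^ (2 - 2 * s - a) *
      ∫ u, majorant a (2 - 2 * s) (‖n‖⁻¹ • n) u := by
    rw [← integral_const_mul, ← Real.norm_eq_abs]
    refine norm_integral_le_of_norm_le (hMi.const_mul _) ?_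
    filter_upwards [compl_mem_ae_iff.2 (measure_singleton (μ := volume)
      (0 : EuclideanSpace ℝ (Fin d)))] with u hu using hgb u hu
  rw [Measure.integral_comp_smul volume g, hfr, smul_eq_mul,
    ← two_mul_integral_eq_integral_add_sub volume hfi n, abs_mul, abs_abs, abs_mul, abs_two,
    abs_of_nonneg (by positivity : 0 ≤ (‖n‖ ^ d)⁻¹), inv_mul_le_iff₀ (by positivity)] at hint
  have hpow : ‖n‖ ^ (-(2 * s) + 2 - 2 * α) = ‖n‖ ^ d * ‖n‖ ^ (2 - 2 * s - a) := by
    rw [← Real.rpow_natCast, ← Real.rpow_add hn']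
    congr 1; rw [ha]; ring
  rw [hpow]
  have := abs_nonneg (∫ k, f k)
  linarith

/-- Uniform-in-cutoff bound: for `d ≥ 2`, `s ∈ (1, d/2)`, `α ∈ (0,1)` and
`C₀ > 0` there is `C` (depending only on `d, s, α, C₀`) such that for every `C²` cutoff
`φ : ℝ^d → [0,1]` with `|Dφ(n)| ≤ C₀|n|^{−1}`, `|D²φ(n)| ≤ C₀|n|^{−2}` for `n ≠ 0`, and every
`n ≠ 0`, the `ℓ²`-operator norm of `𝕂(n)` is at most `C |n|^{−2s+2−2α}`. -/
theorem stmt16 (d : ℕ) (hd : 2 ≤ d) (s α C₀ : ℝ) (hs1 : 1 < s) (hsd : s < (d : ℝ)/2)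
    (hα0 : 0 < α) (hα1 : α < 1) (hC₀ : 0 < C₀) :
    ∃ C : ℝ, 0 ≤ C ∧ ∀ φ : EuclideanSpace ℝ (Fin d) → ℝ,
      ContDiff ℝ 2 φ →
      (∀ n, 0 ≤ φ n ∧ φ n ≤ 1) →
      (∀ n : EuclideanSpace ℝ (Fin d), n ≠ 0 →
        ‖iteratedFDeriv ℝ 1 φ n‖ ≤ C₀ * ‖n‖ ^ (-1 : ℝ)) →
      (∀ n : EuclideanSpace ℝ (Fin d), n ≠ 0 →
        ‖iteratedFDeriv ℝ 2 φ n‖ ≤ C₀ * ‖n‖ ^ (-2 : ℝ)) →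
      ∀ n : EuclideanSpace ℝ (Fin d), n ≠ 0 →
        ‖Matrix.toEuclideanCLM (𝕜 := ℝ) (Kmat d s α φ n)‖
          ≤ C * ‖n‖ ^ (-(2*s) + 2 - 2*α) := by
  refine ⟨d * d * (pairConst d s (d + 2 * α) C₀ *
      majorantMass (volume : Measure (EuclideanSpace ℝ (Fin d))) (d + 2 * α) (2 - 2 * s)), ?_, ?_⟩
  · have := pairConst_nonneg d (d + 2 * α) (by linarith : 0 ≤ s) hC₀.le
    have := majorantMass_nonneg (volume : Measure (EuclideanSpace ℝ (Fin d)))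
      (d + 2 * α) (2 - 2 * s)
    positivity
  · intro φ hφ h0 h1 h2 n hn
    have hK := abs_Kmat_le (by omega : 1 ≤ d) hs1.le hsd hα0 hα1 hC₀.le hφ h0 h1 h2 hn
    have i : Fin d := ⟨0, by omega⟩
    rw [mul_assoc]
    exact norm_toEuclideanCLM_le _ ((abs_nonneg _).trans (hK i i)) hK
end
end

section
/- Let d ≥ 2 be an integer and α ∈ (0,1). Let (σ_k)_{k≥1} be a sequence of divergence-free Schwartz vector fields on ℝ^d such that for all x, y ∈ ℝ^d, ∑_{k≥1} σ_k(x) σ_k(y)ᵀ converges absolutely to Q(x−y). Let M be a divergence-free Schwartz vector field and let G be an even real-valued Schwartz function on ℝ^d. For a vector field σ set B[M]σ := (σ·∇)M − (M·∇)σ. Then ∑_{k≥1} ⟨G ∗ (B[M]σ_k), B[M]σ_k⟩_{L²} = −⟨tr(Q D²G) ∗ M, M⟩ − ⟨((tr Q) D²G) ∗ M, M⟩ + 2⟨(Q D²G) ∗ M, M⟩, where for a matrix-valued kernel A, ⟨A ∗ M, M⟩ := ∫∫ M(x)·A(x−y)M(y) dx dy, D²G is the Hessian of G, Q D²G denotes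 the pointwise matrix product, and tr the matrix trace. -/
open MeasureTheory
open scoped RealInnerProductSpace

noncomputable section

/-- Entries of the projection matrix `P⊥_ξ = I − ξξᵀ/|ξ|²` (junk value `I` at `ξ = 0`). -/
def PperpMat (d : ℕ) (ξ : EuclideanSpace ℝ (Fin d)) (i j : Fin d) : ℝ :=
  (if i = j then (1:ℝ) else 0) - ξ i * ξ j / ‖ξ‖^2

/-- The complex-integral form of the Kraichnan covariance
`Q(z) = (2π)^{−d/2} ∫ e^{iz·ξ} ⟨ξ⟩^{−d−2α} P⊥_ξ dξ` (entrywise). -/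
def Qc (d : ℕ) (α : ℝ) (z : EuclideanSpace ℝ (Fin d)) (i j : Fin d) : ℂ :=
  ((2*Real.pi : ℝ) : ℂ) ^ ((-(d : ℝ)/2 : ℝ) : ℂ)
    * ∫ ξ : EuclideanSpace ℝ (Fin d),
        Complex.exp (Complex.I * ((⟪z, ξ⟫ : ℝ) : ℂ))
          * ((jap ξ ^ (-(d : ℝ) - 2*α) * PperpMat d ξ i j : ℝ) : ℂ)

/-- The (real) Kraichnan covariance matrix function. -/
def Qr (d : ℕ) (α : ℝ) (z : EuclideanSpace ℝ (Fin d)) (i j : Fin d) : ℝ := (Qc d α z i j).re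

/-- Standard basis vector `e_j` of `ℝ^d`. -/
def ebase (d : ℕ) (j : Fin d) : EuclideanSpace ℝ (Fin d) := EuclideanSpace.single j 1

/-- First partial derivative `∂_j f`. -/
def pd (d : ℕ) (f : EuclideanSpace ℝ (Fin d) → ℝ) (x : EuclideanSpace ℝ (Fin d))
    (j : Fin d) : ℝ := fderiv ℝ f x (ebase d j)

/-- Second partial derivative `∂_j ∂_i f`, i.e. the Hessian entry `(D²f)_{ij}`. -/
def pd2 (d : ℕ) (f : EuclideanSpace ℝ (Fin d) → ℝ) (x : EuclideanSpace ℝ (Fin d))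
    (i j : Fin d) : ℝ := fderiv ℝ (fun y => fderiv ℝ f y (ebase d i)) x (ebase d j)

/-- A (componentwise) vector field is divergence free: `∑ᵢ ∂ᵢ vᵢ = 0`. -/
def DivFree (d : ℕ) (v : Fin d → (EuclideanSpace ℝ (Fin d) → ℝ)) : Prop :=
  ∀ x, ∑ i, pd d (v i) x i = 0

/-- `B[M]σ = (σ·∇)M − (M·∇)σ`, componentwise. -/
def Bop (d : ℕ) (M σ : Fin d → (EuclideanSpace ℝ (Fin d) → ℝ)) (i : Fin d)
    (x : EuclideanSpace ℝ (Fin d)) : ℝ :=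
  (∑ j, σ j x * pd d (M i) x j) - (∑ j, M j x * pd d (σ i) x j)

open LineDeriv in
/-- The partial derivative `∂_j f` of a Schwartz function, as a Schwartz function. -/
def schwartzPd (d : ℕ) (j : Fin d) (f : SchwartzMap (EuclideanSpace ℝ (Fin d)) ℝ) :
    SchwartzMap (EuclideanSpace ℝ (Fin d)) ℝ := ∂_{ebase d j} f

/-- The pointwise product of two Schwartz functions. -/
def schwartzMul {d : ℕ} (f g : SchwartzMap (EuclideanSpace ℝ (Fin d)) ℝ) :
    SchwartzMap (EuclideanSpace ℝ (Fin d)) ℝ :=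
  SchwartzMap.pairing (ContinuousLinearMap.mul ℝ ℝ) f g

/-- The bilinear form `∫∫ K(x − y) f(x) g(y) dx dy` of a convolution kernel `K`. -/
def kernelForm {d : ℕ} (K f g : EuclideanSpace ℝ (Fin d) → ℝ) : ℝ :=
  ∫ p : EuclideanSpace ℝ (Fin d) × EuclideanSpace ℝ (Fin d), K (p.1 - p.2) * (f p.1 * g p.2)

section Kernel

variable {d : ℕ}

lemma schwartzPd_apply (j : Fin d) (f : SchwartzMap (EuclideanSpace ℝ (Fin d)) ℝ)
    (x : EuclideanSpace ℝ (Fin d)) : schwartzPd d j f x = fderiv ℝ f x (ebase d j) :=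
  SchwartzMap.lineDerivOp_apply_eq_fderiv _ _ _

lemma pd2_eq_schwartzPd (f : SchwartzMap (EuclideanSpace ℝ (Fin d)) ℝ)
    (x : EuclideanSpace ℝ (Fin d)) (i j : Fin d) :
    pd2 d f x i j = schwartzPd d j (schwartzPd d i f) x := by
  rw [schwartzPd_apply, funext (schwartzPd_apply i f), pd2]

lemma schwartzMul_apply (f g : SchwartzMap (EuclideanSpace ℝ (Fin d)) ℝ)
    (x : EuclideanSpace ℝ (Fin d)) : schwartzMul f g x = f x * g x := by
  simp [schwartzMul]

lemma schwartzPd_sub_schwartzMul (f₁ f₂ g₁ g₂ : SchwartzMap (EuclideanSpace ℝ (Fin d)) ℝ)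
    (j : Fin d) (x : EuclideanSpace ℝ (Fin d)) :
    schwartzPd d j (schwartzMul f₁ f₂ - schwartzMul g₁ g₂) x
      = pd d f₁ x j * f₂ x + f₁ x * pd d f₂ x j - (pd d g₁ x j * g₂ x + g₁ x * pd d g₂ x j) := by
  have h : ((schwartzMul f₁ f₂ - schwartzMul g₁ g₂ : SchwartzMap (EuclideanSpace ℝ (Fin d)) ℝ) :
      EuclideanSpace ℝ (Fin d) → ℝ) = (⇑f₁ * ⇑f₂) - (⇑g₁ * ⇑g₂) := by
    ext y
    simp [schwartzMul_apply]
  have hd (f : SchwartzMap (EuclideanSpace ℝ (Fin d)) ℝ) : DifferentiableAt ℝ f x :=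
    f.differentiable x
  rw [schwartzPd_apply, h, fderiv_sub ((hd _).mul (hd _)) ((hd _).mul (hd _)),
    fderiv_mul (hd _) (hd _), fderiv_mul (hd _) (hd _)]
  simp [pd]
  ring

lemma pd2_symm (f : SchwartzMap (EuclideanSpace ℝ (Fin d)) ℝ)
    (x : EuclideanSpace ℝ (Fin d)) (i j : Fin d) : pd2 d f x i j = pd2 d f x j i := by
  have hf' : DifferentiableAt ℝ (fderiv ℝ f) x :=
    ((f.smooth 2).fderiv_right (m := 1) le_rfl).differentiable one_ne_zero x
  have h (v w : EuclideanSpace ℝ (Fin d)) :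
      fderiv ℝ (fun y => fderiv ℝ f y v) x w = fderiv ℝ (fderiv ℝ f) x w v := by
    rw [fderiv_clm_apply hf' (differentiableAt_const v)]
    simp
  rw [pd2, pd2, h, h]
  exact second_derivative_symmetric (fun y => (f.differentiable y).hasFDerivAt) hf'.hasFDerivAt _ _

lemma fderiv_comp_neg_apply (f : EuclideanSpace ℝ (Fin d) → ℝ) (x v : EuclideanSpace ℝ (Fin d)) :
    fderiv ℝ (fun y => f (-y)) x v = -fderiv ℝ f (-x) v := by
  have h := (ContinuousLinearEquiv.neg ℝ (M := EuclideanSpace ℝ (Fin d))).comp_right_fderiv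
    (f := f) (x := x)
  have h' := congrArg (fun L => L v) h
  simpa [Function.comp_def] using h'

lemma pd2_neg_of_even {f : EuclideanSpace ℝ (Fin d) → ℝ} (hf : ∀ x, f (-x) = f x)
    (x : EuclideanSpace ℝ (Fin d)) (i j : Fin d) : pd2 d f (-x) i j = pd2 d f x i j := by
  have h' : (fun y => fderiv ℝ f y (ebase d i))
      = fun y => (fun z => -fderiv ℝ f z (ebase d i)) (-y) := by
    ext y
    conv_lhs => rw [← funext hf]
    exact fderiv_comp_neg_apply f y _
  rw [pd2, pd2]
  conv_rhs => rw [h', fderiv_comp_neg_apply fun z => -fderiv ℝ f z (ebase d i)]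
  simp [fderiv_fun_neg]

lemma exists_abs_schwartz_le (f : SchwartzMap (EuclideanSpace ℝ (Fin d)) ℝ) :
    ∃ C, ∀ x, |f x| ≤ C :=
  ⟨_, fun x => SchwartzMap.norm_le_seminorm ℝ f x⟩

lemma integrable_kernel {K f g : EuclideanSpace ℝ (Fin d) → ℝ} (hK : Measurable K)
    (hb : ∃ C, ∀ z, |K z| ≤ C) (hf : Integrable f) (hg : Integrable g) :
    Integrable (fun p : EuclideanSpace ℝ (Fin d) × EuclideanSpace ℝ (Fin d) =>
      K (p.1 - p.2) * (f p.1 * g p.2)) := by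
  obtain ⟨C, hC⟩ := hb
  exact (hf.mul_prod hg).bdd_mul (c := C)
    (hK.comp (measurable_fst.sub measurable_snd)).aestronglyMeasurable
    (.of_forall fun p => hC _)

lemma integral_comp_const_sub_mul_schwartzPd (G g : SchwartzMap (EuclideanSpace ℝ (Fin d)) ℝ)
    (x : EuclideanSpace ℝ (Fin d)) (j : Fin d) :
    ∫ y, G (x - y) * schwartzPd d j g y = ∫ y, schwartzPd d j G (x - y) * g y := by
  have hint (H h : SchwartzMap (EuclideanSpace ℝ (Fin d)) ℝ) :
      Integrable (fun y => H (x - y) * h y) := by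
    obtain ⟨C, hC⟩ := exists_abs_schwartz_le H
    exact h.integrable.bdd_mul (c := C)
      (H.continuous.comp (continuous_const.sub continuous_id)).aestronglyMeasurable
      (.of_forall fun p => hC _)
  have hd (y) : HasFDerivAt (fun y => G (x - y)) (-fderiv ℝ G (x - y)) y := by
    have := (G.differentiable (x - y)).hasFDerivAt.comp y ((hasFDerivAt_id y).const_sub x)
    rw [ContinuousLinearMap.comp_neg, ContinuousLinearMap.comp_id] at this
    exact this
  have h' (y) : fderiv ℝ (fun y => G (x - y)) y (ebase d j) = -schwartzPd d j G (x - y) := by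
    rw [(hd y).fderiv, schwartzPd_apply]; rfl
  simp_rw [schwartzPd_apply j g]
  rw [integral_mul_fderiv_eq_neg_fderiv_mul_of_integrable (f := fun y => G (x - y)) (g := g)]
  · simp_rw [h', neg_mul, integral_neg, neg_neg]
  · simp_rw [h', neg_mul]
    exact (hint _ _).neg
  · simpa only [schwartzPd_apply] using hint G (schwartzPd d j g)
  · exact hint _ _
  · exact fun y _ => (hd y).differentiableAt
  · exact fun y _ => g.differentiable y

lemma integral_sub_const_mul_schwartzPd (G g : SchwartzMap (EuclideanSpace ℝ (Fin d)) ℝ)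
    (y : EuclideanSpace ℝ (Fin d)) (j : Fin d) :
    ∫ x, G (x - y) * schwartzPd d j g x = -∫ x, schwartzPd d j G (x - y) * g x := by
  have hint (H h : SchwartzMap (EuclideanSpace ℝ (Fin d)) ℝ) :
      Integrable (fun x => H (x - y) * h x) := by
    obtain ⟨C, hC⟩ := exists_abs_schwartz_le H
    exact h.integrable.bdd_mul (c := C)
      (H.continuous.comp (continuous_id.sub continuous_const)).aestronglyMeasurable
      (.of_forall fun p => hC _)
  have h' (x) : fderiv ℝ (fun x => G (x - y)) x (ebase d j) = schwartzPd d j G (x - y) := by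
    rw [fderiv_comp_sub, schwartzPd_apply]
  simp_rw [schwartzPd_apply j g]
  rw [integral_mul_fderiv_eq_neg_fderiv_mul_of_integrable (f := fun x => G (x - y)) (g := g)]
  · simp_rw [h']
  · simp_rw [h']
    exact hint _ _
  · simpa only [schwartzPd_apply] using hint G (schwartzPd d j g)
  · exact hint _ _
  · exact fun x _ => (G.differentiable (x - y)).comp x (differentiableAt_id.sub_const y)
  · exact fun x _ => g.differentiable x

lemma integrable_schwartz_kernel (H f g : SchwartzMap (EuclideanSpace ℝ (Fin d)) ℝ) :
    Integrable (fun p : EuclideanSpace ℝ (Fin d) × EuclideanSpace ℝ (Fin d) =>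
      H (p.1 - p.2) * (f p.1 * g p.2)) :=
  integrable_kernel H.continuous.measurable (exists_abs_schwartz_le H) f.integrable g.integrable

lemma integrable_convolution_mul (H f g : SchwartzMap (EuclideanSpace ℝ (Fin d)) ℝ) :
    Integrable (fun x => (∫ y, H (x - y) * g y) * f x) := by
  have := (integrable_schwartz_kernel H f g).integral_prod_left
  refine this.congr (.of_forall fun x => ?_)
  simp only [← integral_mul_const]
  congr 1 with y
  ring

lemma integral_convolution_mul_eq_kernelForm
    (H f g : SchwartzMap (EuclideanSpace ℝ (Fin d)) ℝ) :
    ∫ x, (∫ y, H (x - y) * g y) * f x = kernelForm H f g := by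
  rw [kernelForm, Measure.volume_eq_prod, integral_prod _ (integrable_schwartz_kernel H f g)]
  congr 1 with x
  rw [← integral_mul_const]
  congr 1 with y
  ring

lemma kernelForm_schwartzPd_left (H f g : SchwartzMap (EuclideanSpace ℝ (Fin d)) ℝ) (j : Fin d) :
    kernelForm H (schwartzPd d j f) g = -kernelForm (schwartzPd d j H) f g := by
  have key (H f : SchwartzMap (EuclideanSpace ℝ (Fin d)) ℝ) :
      kernelForm H f g = ∫ y, (∫ x, H (x - y) * f x) * g y := by
    rw [kernelForm, Measure.volume_eq_prod, integral_prod_symm _ (integrable_schwartz_kernel H f g)]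
    congr 1 with y
    rw [← integral_mul_const]
    congr 1 with x
    ring
  simp_rw [key, integral_sub_const_mul_schwartzPd, neg_mul, integral_neg]

lemma integral_convolution_schwartzPd_mul_schwartzPd
    (G f g : SchwartzMap (EuclideanSpace ℝ (Fin d)) ℝ) (j l : Fin d) :
    ∫ x, (∫ y, G (x - y) * schwartzPd d l g y) * schwartzPd d j f x
      = -kernelForm (fun z => pd2 d G z l j) f g := by
  simp_rw [integral_comp_const_sub_mul_schwartzPd, integral_convolution_mul_eq_kernelForm,
    kernelForm_schwartzPd_left, pd2_eq_schwartzPd]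

lemma integral_convolution_divergence (G : SchwartzMap (EuclideanSpace ℝ (Fin d)) ℝ)
    (F : Fin d → Fin d → SchwartzMap (EuclideanSpace ℝ (Fin d)) ℝ) :
    ∫ x, ∑ i, (∫ y, G (x - y) * ∑ l, schwartzPd d l (F i l) y) * ∑ j, schwartzPd d j (F i j) x
      = -∑ i, ∑ j, ∑ l, kernelForm (fun z => pd2 d G z l j) (F i j) (F i l) := by
  have hint (x) (h : SchwartzMap (EuclideanSpace ℝ (Fin d)) ℝ) :
      Integrable (fun y => G (x - y) * h y) := by
    obtain ⟨C, hC⟩ := exists_abs_schwartz_le G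
    exact h.integrable.bdd_mul (c := C)
      (G.continuous.comp (continuous_const.sub continuous_id)).aestronglyMeasurable
      (.of_forall fun p => hC _)
  have h (x) : ∑ i, (∫ y, G (x - y) * ∑ l, schwartzPd d l (F i l) y)
        * ∑ j, schwartzPd d j (F i j) x
      = ∑ i, ∑ j, ∑ l, (∫ y, G (x - y) * schwartzPd d l (F i l) y)
        * schwartzPd d j (F i j) x := by
    refine Finset.sum_congr rfl fun i _ => ?_
    simp_rw [Finset.mul_sum]
    rw [integral_finsetSum _ fun l _ => hint x _]
    simp_rw [Finset.sum_mul]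
  simp_rw [h]
  rw [integral_finsetSum _ fun i _ => integrable_finsetSum _ fun j _ =>
    integrable_finsetSum _ fun l _ => integrable_convolution_mul _ _ _, ← Finset.sum_neg_distrib]
  refine Finset.sum_congr rfl fun i _ => ?_
  rw [integral_finsetSum _ fun j _ =>
    integrable_finsetSum _ fun l _ => integrable_convolution_mul _ _ _, ← Finset.sum_neg_distrib]
  refine Finset.sum_congr rfl fun j _ => ?_
  rw [integral_finsetSum _ fun l _ => integrable_convolution_mul _ _ _, ← Finset.sum_neg_distrib]
  exact Finset.sum_congr rfl fun l _ => integral_convolution_schwartzPd_mul_schwartzPd _ _ _ _ _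

lemma kernelForm_swap {K : EuclideanSpace ℝ (Fin d) → ℝ} (hK : ∀ z, K (-z) = K z)
    (f g : EuclideanSpace ℝ (Fin d) → ℝ) : kernelForm K f g = kernelForm K g f := by
  rw [kernelForm, kernelForm, Measure.volume_eq_prod, ← integral_prod_swap]
  congr 1 with p
  rw [Prod.fst_swap, Prod.snd_swap, ← hK, neg_sub, mul_comm (f p.2)]

lemma kernelForm_sub_sub {K : EuclideanSpace ℝ (Fin d) → ℝ} (hK : Measurable K)
    (hb : ∃ C, ∀ z, |K z| ≤ C) (f₁ f₂ g₁ g₂ : SchwartzMap (EuclideanSpace ℝ (Fin d)) ℝ) :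
    kernelForm K (f₁ - f₂ : SchwartzMap (EuclideanSpace ℝ (Fin d)) ℝ)
        (g₁ - g₂ : SchwartzMap (EuclideanSpace ℝ (Fin d)) ℝ)
      = kernelForm K f₁ g₁ - kernelForm K f₁ g₂ - kernelForm K f₂ g₁ + kernelForm K f₂ g₂ := by
  have hint (f g : SchwartzMap (EuclideanSpace ℝ (Fin d)) ℝ) :=
    integrable_kernel hK hb f.integrable g.integrable
  simp only [kernelForm]
  rw [← integral_sub (hint _ _) (hint _ _), ← integral_sub (by exact (hint _ _).sub (hint _ _))
    (hint _ _), ← integral_add (by exact ((hint _ _).sub (hint _ _)).sub (hint _ _)) (hint _ _)]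
  congr 1 with p
  simp only [sub_apply]
  ring

lemma integral_integral_sum_kernel {ι : Type*} [Fintype ι]
    {K : ι → EuclideanSpace ℝ (Fin d) → ℝ} (hK : ∀ a, Measurable (K a))
    (hb : ∀ a, ∃ C, ∀ z, |K a z| ≤ C) (f g : ι → SchwartzMap (EuclideanSpace ℝ (Fin d)) ℝ) :
    ∫ x, ∫ y, ∑ a, K a (x - y) * (f a x * g a y) = ∑ a, kernelForm (K a) (f a) (g a) := by
  have hint (a : ι) := integrable_kernel (hK a) (hb a) (f a).integrable (g a).integrable
  simp only [kernelForm]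
  rw [← integral_finsetSum _ fun a _ => hint a, Measure.volume_eq_prod,
    integral_prod _ (integrable_finsetSum _ fun a _ => hint a)]

lemma hasSum_kernelForm_schwartzMul {s t : ℕ → SchwartzMap (EuclideanSpace ℝ (Fin d)) ℝ}
    {K H : EuclideanSpace ℝ (Fin d) → ℝ} {A B : ℝ}
    (hst : ∀ x y, HasSum (fun k => s k x * t k y) (K (x - y)))
    (hs : ∀ x, HasSum (fun k => s k x * s k x) A) (ht : ∀ x, HasSum (fun k => t k x * t k x) B)
    (hH : Measurable H) (hb : ∃ C, ∀ z, |H z| ≤ C)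
    (w v : SchwartzMap (EuclideanSpace ℝ (Fin d)) ℝ) :
    HasSum (fun k => kernelForm H (schwartzMul (s k) w) (schwartzMul (t k) v))
      (kernelForm (fun z => K z * H z) w v) := by
  have hsum (p : EuclideanSpace ℝ (Fin d) × EuclideanSpace ℝ (Fin d)) :
      HasSum (fun k => (s k p.1 * s k p.1 + t k p.2 * t k p.2)
        * |H (p.1 - p.2) * (w p.1 * v p.2)|) ((A + B) * |H (p.1 - p.2) * (w p.1 * v p.2)|) :=
    ((hs p.1).add (ht p.2)).mul_right _
  refine hasSum_integral_of_dominated_convergence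
    (fun k p => (s k p.1 * s k p.1 + t k p.2 * t k p.2) * |H (p.1 - p.2) * (w p.1 * v p.2)|)
    (fun k => ?_) (fun k => .of_forall fun p => ?_) (.of_forall fun p => (hsum p).summable) ?_
    (.of_forall fun p => ?_)
  · exact (integrable_kernel hH hb (SchwartzMap.integrable _)
      (SchwartzMap.integrable _)).aestronglyMeasurable
  · have h : H (p.1 - p.2) * (schwartzMul (s k) w p.1 * schwartzMul (t k) v p.2)
        = (s k p.1 * t k p.2) * (H (p.1 - p.2) * (w p.1 * v p.2)) := by
      rw [schwartzMul_apply, schwartzMul_apply]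
      ring
    rw [h, Real.norm_eq_abs, abs_mul]
    gcongr
    rw [abs_le]
    constructor <;> nlinarith [sq_nonneg (s k p.1 - t k p.2), sq_nonneg (s k p.1 + t k p.2),
      sq_nonneg (s k p.1), sq_nonneg (t k p.2)]
  · rw [funext fun p => (hsum p).tsum_eq]
    exact (integrable_kernel hH hb w.integrable v.integrable).abs.const_mul _
  · have h := (hst p.1 p.2).mul_right (H (p.1 - p.2) * (w p.1 * v p.2))
    rw [← mul_assoc (K _)] at h
    refine (congrArg (fun F : ℕ → ℝ => HasSum F _) (funext fun k => ?_)).mpr h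
    rw [schwartzMul_apply, schwartzMul_apply]
    ring

lemma Qr_symm (α : ℝ) (z : EuclideanSpace ℝ (Fin d)) (i j : Fin d) :
    Qr d α z i j = Qr d α z j i := by
  simp only [Qr, Qc, PperpMat, eq_comm (a := i) (b := j), mul_comm (_ : ℝ) (_ : ℝ)]

lemma bop_eq_sum_schwartzPd {M s : Fin d → SchwartzMap (EuclideanSpace ℝ (Fin d)) ℝ}
    (hM : DivFree d (fun i => (M i : EuclideanSpace ℝ (Fin d) → ℝ)))
    (hs : DivFree d (fun i => (s i : EuclideanSpace ℝ (Fin d) → ℝ)))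
    (i : Fin d) (x : EuclideanSpace ℝ (Fin d)) :
    Bop d (fun i => (M i : EuclideanSpace ℝ (Fin d) → ℝ))
        (fun i => (s i : EuclideanSpace ℝ (Fin d) → ℝ)) i x
      = ∑ j, schwartzPd d j (schwartzMul (s j) (M i) - schwartzMul (s i) (M j)) x := by
  simp_rw [schwartzPd_sub_schwartzMul, Finset.sum_sub_distrib, Finset.sum_add_distrib,
    ← Finset.sum_mul, ← Finset.mul_sum]
  rw [hM x, hs x, Bop]
  simp_rw [mul_comm (M _ x)]
  ring

section Covariance

variable {α : ℝ} {σ : ℕ → Fin d → SchwartzMap (EuclideanSpace ℝ (Fin d)) ℝ}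
  (hQ : ∀ x y : EuclideanSpace ℝ (Fin d), ∀ i j : Fin d,
    HasSum (fun k => σ k i x * σ k j y) (Qr d α (x - y) i j))
include hQ

lemma measurable_Qr (i j : Fin d) : Measurable fun z => Qr d α z i j := by
  refine measurable_of_tendsto_metrizable
    (f := fun n z => ∑ k ∈ Finset.range n, σ k i z * σ k j 0) (fun n => ?_)
    (tendsto_pi_nhds.2 fun z => ?_)
  · exact Finset.measurable_fun_sum _ fun k _ => (σ k i).continuous.measurable.mul_const _
  · simpa using (hQ z 0 i j).tendsto_sum_nat

lemma abs_Qr_le (z : EuclideanSpace ℝ (Fin d)) (i j : Fin d) :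
    |Qr d α z i j| ≤ Qr d α 0 i i + Qr d α 0 j j := by
  have h := hQ z 0 i j
  have hs := hQ z z i i
  have ht := hQ 0 0 j j
  rw [sub_zero] at h ht
  rw [sub_self] at hs
  rw [abs_le]
  constructor
  · refine hasSum_le (fun k => ?_) (hs.add ht).neg h
    nlinarith [sq_nonneg (σ k i z + σ k j 0), sq_nonneg (σ k i z), sq_nonneg (σ k j 0)]
  · refine hasSum_le (fun k => ?_) h (hs.add ht)
    nlinarith [sq_nonneg (σ k i z - σ k j 0), sq_nonneg (σ k i z), sq_nonneg (σ k j 0)]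

lemma Qr_neg (z : EuclideanSpace ℝ (Fin d)) (i j : Fin d) :
    Qr d α (-z) i j = Qr d α z i j := by
  have h := hQ 0 z i j
  have h' := hQ z 0 j i
  simp_rw [mul_comm (σ _ j z)] at h'
  rw [zero_sub] at h
  rw [sub_zero] at h'
  rw [h.unique h', Qr_symm]

end Covariance

lemma measurable_pd2 (G : SchwartzMap (EuclideanSpace ℝ (Fin d)) ℝ) (i j : Fin d) :
    Measurable fun z => pd2 d G z i j := by
  simp_rw [pd2_eq_schwartzPd]
  exact (SchwartzMap.continuous _).measurable

lemma exists_abs_pd2_le (G : SchwartzMap (EuclideanSpace ℝ (Fin d)) ℝ) (i j : Fin d) :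
    ∃ C, ∀ z, |pd2 d G z i j| ≤ C := by
  simp_rw [pd2_eq_schwartzPd]
  exact exists_abs_schwartz_le _

end Kernel

/-- Quadratic-variation identity for the transport-plus-stretching operator:
if the divergence-free Schwartz fields `σ_k` satisfy `∑ₖ σ_k(x)σ_k(y)ᵀ = Q(x−y)` (absolutely),
then for every divergence-free Schwartz field `M` and even Schwartz `G`,
`∑ₖ ⟨G ∗ B[M]σ_k, B[M]σ_k⟩_{L²}
  = −⟨tr(Q D²G) ∗ M, M⟩ − ⟨(tr Q) D²G ∗ M, M⟩ + 2⟨(Q D²G) ∗ M, M⟩`. -/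
theorem stmt17 (d : ℕ) (hd : 2 ≤ d) (α : ℝ) (hα0 : 0 < α) (hα1 : α < 1)
    (σ : ℕ → Fin d → SchwartzMap (EuclideanSpace ℝ (Fin d)) ℝ)
    (hσdiv : ∀ k, DivFree d (fun i => (σ k i : EuclideanSpace ℝ (Fin d) → ℝ)))
    (habs : ∀ x y : EuclideanSpace ℝ (Fin d), ∀ i j : Fin d,
      Summable (fun k => |σ k i x * σ k j y|))
    (hQ : ∀ x y : EuclideanSpace ℝ (Fin d), ∀ i j : Fin d,
      HasSum (fun k => σ k i x * σ k j y) (Qr d α (x - y) i j))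
    (M : Fin d → SchwartzMap (EuclideanSpace ℝ (Fin d)) ℝ)
    (hMdiv : DivFree d (fun i => (M i : EuclideanSpace ℝ (Fin d) → ℝ)))
    (G : SchwartzMap (EuclideanSpace ℝ (Fin d)) ℝ)
    (hGeven : ∀ x, G (-x) = G x) :
    HasSum
      (fun k => ∫ x : EuclideanSpace ℝ (Fin d), ∑ i,
        (∫ y : EuclideanSpace ℝ (Fin d),
            G (x - y) * Bop d (fun i => (M i : EuclideanSpace ℝ (Fin d) → ℝ))
              (fun i => (σ k i : EuclideanSpace ℝ (Fin d) → ℝ)) i y)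
          * Bop d (fun i => (M i : EuclideanSpace ℝ (Fin d) → ℝ))
              (fun i => (σ k i : EuclideanSpace ℝ (Fin d) → ℝ)) i x)
      (-(∫ x : EuclideanSpace ℝ (Fin d), ∫ y : EuclideanSpace ℝ (Fin d),
            (∑ i, ∑ j, Qr d α (x - y) i j * pd2 d (G : EuclideanSpace ℝ (Fin d) → ℝ) (x - y) j i)
              * (∑ i, M i x * M i y))
        - (∫ x : EuclideanSpace ℝ (Fin d), ∫ y : EuclideanSpace ℝ (Fin d),
            ∑ i, ∑ j, M i x
              * ((∑ l, Qr d α (x - y) l l)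
                  * pd2 d (G : EuclideanSpace ℝ (Fin d) → ℝ) (x - y) i j) * M j y)
        + 2 * (∫ x : EuclideanSpace ℝ (Fin d), ∫ y : EuclideanSpace ℝ (Fin d),
            ∑ i, ∑ j, M i x
              * (∑ l, Qr d α (x - y) i l
                  * pd2 d (G : EuclideanSpace ℝ (Fin d) → ℝ) (x - y) l j) * M j y)) := by
  have hKm (a b p q : Fin d) : Measurable fun z => Qr d α z a b * pd2 d G z p q :=
    (measurable_Qr hQ a b).mul (measurable_pd2 G p q)
  have hKb (a b p q : Fin d) : ∃ C, ∀ z, |Qr d α z a b * pd2 d G z p q| ≤ C := by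
    obtain ⟨C, hC⟩ := exists_abs_pd2_le G p q
    refine ⟨(Qr d α 0 a a + Qr d α 0 b b) * C, fun z => ?_⟩
    rw [abs_mul]
    exact mul_le_mul (abs_Qr_le hQ z a b) (hC z) (abs_nonneg _)
      ((abs_nonneg _).trans (abs_Qr_le hQ z a b))
  have hself (i : Fin d) (x : EuclideanSpace ℝ (Fin d)) :
      HasSum (fun k => σ k i x * σ k i x) (Qr d α 0 i i) := by
    simpa using hQ x x i i
  have hterm (a b p q : Fin d) (w v : SchwartzMap (EuclideanSpace ℝ (Fin d)) ℝ) :=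
    hasSum_kernelForm_schwartzMul (K := fun z => Qr d α z a b) (fun x y => hQ x y a b) (hself a) (hself b)
      (measurable_pd2 G p q) (exists_abs_pd2_le G p q) w v
  let R : Fin d → Fin d → Fin d → Fin d → Fin d → Fin d → ℝ := fun a b p q u v =>
    kernelForm (fun z => Qr d α z a b * pd2 d G z p q) (M u) (M v)
  have hQsymm (a b p q u v) : R a b p q u v = R b a p q u v := by
    simp only [R, Qr_symm α _ a b]
  have hGsymm (a b p q u v) : R a b p q u v = R a b q p u v := by
    simp only [R, pd2_symm G _ p q]
  have hswap (a b p q u v) : R a b p q u v = R a b p q v u :=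
    kernelForm_swap (fun z => by rw [Qr_neg hQ, pd2_neg_of_even hGeven]) _ _
  have hint (a b p q u v : Fin d × Fin d × Fin d → Fin d) :
      ∫ x, ∫ y, ∑ i, ∑ j, ∑ l, Qr d α (x - y) (a (i, j, l)) (b (i, j, l))
          * pd2 d G (x - y) (p (i, j, l)) (q (i, j, l)) * (M (u (i, j, l)) x * M (v (i, j, l)) y)
        = ∑ i, ∑ j, ∑ l, R (a (i, j, l)) (b (i, j, l)) (p (i, j, l)) (q (i, j, l))
          (u (i, j, l)) (v (i, j, l)) := by
    have h := integral_integral_sum_kernel (fun c => hKm (a c) (b c) (p c) (q c))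
      (fun c => hKb (a c) (b c) (p c) (q c)) (fun c => M (u c)) (fun c => M (v c))
    simpa only [Fintype.sum_prod_type] using h
  have h₁ : (∫ x, ∫ y, (∑ i, ∑ j, Qr d α (x - y) i j * pd2 d G (x - y) j i)
      * (∑ i, M i x * M i y)) = ∑ i, ∑ j, ∑ l, R j l l j i i := by
    have h := hint (·.1) (·.2.1) (·.2.1) (·.1) (·.2.2) (·.2.2)
    simp_rw [← Finset.mul_sum, ← Finset.sum_mul] at h
    rw [h, Finset.sum_comm_cycle]
  have h₂ : (∫ x, ∫ y, ∑ i, ∑ j, M i x * ((∑ l, Qr d α (x - y) l l) * pd2 d G (x - y) i j) * M j y)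
      = ∑ i, ∑ j, ∑ l, R i i l j j l := by
    have h := hint (·.2.2) (·.2.2) (·.1) (·.2.1) (·.1) (·.2.1)
    simp_rw [← Finset.sum_mul] at h
    rw [Finset.sum_comm_cycle] at h
    simp_rw [hGsymm _ _ _ _ _ _, ← h]
    congr! 6
    ring
  have h₃ : (∫ x, ∫ y, ∑ i, ∑ j, M i x * (∑ l, Qr d α (x - y) i l * pd2 d G (x - y) l j) * M j y)
      = ∑ i, ∑ j, ∑ l, R i l l j i j := by
    have h := hint (·.1) (·.2.2) (·.2.2) (·.2.1) (·.1) (·.2.1)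
    simp_rw [← Finset.sum_mul] at h
    rw [← h]
    congr! 6
    ring
  have h₄ : ∑ i, ∑ j, ∑ l, R j i l j i l = ∑ i, ∑ j, ∑ l, R i l l j i j := by
    refine Finset.sum_congr rfl fun i _ => ?_
    rw [Finset.sum_comm]
    refine Finset.sum_congr rfl fun j _ => Finset.sum_congr rfl fun l _ => ?_
    rw [hQsymm, hGsymm]
  have h₅ : ∑ i, ∑ j, ∑ l, R i l l j j i = ∑ i, ∑ j, ∑ l, R i l l j i j := by
    simp_rw [hswap _ _ _ _ _ _]
  have hsum : -(∑ i, ∑ j, ∑ l, R j l l j i i) - ∑ i, ∑ j, ∑ l, R i i l j j l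
        + 2 * ∑ i, ∑ j, ∑ l, R i l l j i j
      = -∑ i, ∑ j, ∑ l, (R j l l j i i - R j i l j i l - R i l l j j i + R i i l j j l) := by
    simp only [Finset.sum_add_distrib, Finset.sum_sub_distrib]
    rw [h₄, h₅]
    ring
  rw [h₁, h₂, h₃, hsum]
  simp_rw [bop_eq_sum_schwartzPd hMdiv (hσdiv _), integral_convolution_divergence,
    kernelForm_sub_sub (measurable_pd2 G _ _) (exists_abs_pd2_le G _ _)]
  exact (hasSum_sum fun i _ => hasSum_sum fun j _ => hasSum_sum fun l _ =>
    (((hterm j l l j (M i) (M i)).sub (hterm j i l j (M i) (M l))).sub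
      (hterm i l l j (M j) (M i))).add (hterm i i l j (M j) (M l))).neg
end
end
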